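/- Let G be a locally finite simple graph with a special pair (φ, {V₁, V₂, V₃}), let λ be a real number, and let h : V(G) → ℝ be a function in the λ-eigenspace of G satisfying h(x) = −h(φ(x)) for all x ∈ V(G) (for instance h(x) = f(x) − f(φ(x)) for f in the λ-eigenspace). Then the restriction h₁ of h to V₁ lies in the (λ+1)-eigenspace of the induced subgraph G[V₁], i.e. (λ+1)·h(x) = Σ_{y ∈ N_{G[V₁]}(x)} h(y) for every x ∈ V₁. -/

import Mathlib

/-- `f` lies in the `lam`-eigenspace of the graph `G`, i.e.
`lam * f x = ∑_{y ∈ N_G(x)} f y` for every vertex `x`. -/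
def IsEigenfun {V : Type*} (G : SimpleGraph V) [∀ v, Fintype (G.neighborSet v)]
    (lam : ℝ) (f : V → ℝ) : Prop :=
  ∀ x : V, lam * f x = ∑ y ∈ G.neighborFinset x, f y

/-- `(φ, {V₁, V₂, V₃})` is a special pair of the graph `G`. -/
structure SpecialPair {V : Type*} (G : SimpleGraph V) (φ : G ≃g G)
    (V₁ V₂ V₃ : Set V) : Prop where
  disj₁₂ : Disjoint V₁ V₂
  disj₁₃ : Disjoint V₁ V₃
  disj₂₃ : Disjoint V₂ V₃
  union_eq : V₁ ∪ V₂ ∪ V₃ = Set.univ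
  image₁ : ⇑φ '' V₁ = V₂
  image₂ : ⇑φ '' V₂ = V₁
  nbhd₁ : ∀ x ∈ V₁, G.neighborSet x ∩ V₂ = {φ x}
  nbhd₂ : ∀ x ∈ V₂, G.neighborSet x ∩ V₁ = {φ x}
  fixed : ∀ x ∈ V₃, φ x = x

theorem stmt_5 {V : Type*} (G : SimpleGraph V) [∀ v, Fintype (G.neighborSet v)]
    (φ : G ≃g G) (V₁ V₂ V₃ : Set V) (hP : SpecialPair G φ V₁ V₂ V₃)
    (lam : ℝ) (h : V → ℝ) (hh : IsEigenfun G lam h)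
    (hanti : ∀ x : V, h x = - h (φ x))
    [∀ v : V₁, Fintype ((G.induce V₁).neighborSet v)] :
    IsEigenfun (G.induce V₁) (lam + 1) (fun x => h x.val) := by
  classical
  rintro ⟨x, hx⟩
  have mem_nbr : φ x ∈ G.neighborSet x ∩ V₂ := by
    rw [hP.nbhd₁ x hx]
    rfl
  have zero_of_fixed (y : V) (hy : y ∈ V₃) : h y = 0 := by
    have := hanti y
    rw [hP.fixed y hy] at this
    linarith
  have sum_outside : ∑ y ∈ G.neighborFinset x with y ∉ V₁, h y = h (φ x) := by
    apply Finset.sum_eq_single_of_mem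
    · simpa using ⟨mem_nbr.1, hP.disj₁₂.notMem_of_mem_right mem_nbr.2⟩
    · intro y hy hne
      rw [Finset.mem_filter, SimpleGraph.mem_neighborFinset] at hy
      rcases hP.union_eq.ge (Set.mem_univ y) with (hy₁ | hy₂) | hy₃
      · exact absurd hy₁ hy.2
      · have : y ∈ G.neighborSet x ∩ V₂ := ⟨hy.1, hy₂⟩
        rw [hP.nbhd₁ x hx] at this
        exact absurd this hne
      · exact zero_of_fixed y hy₃
  have sum_inside : ∑ y ∈ G.neighborFinset x with y ∈ V₁, h y =
      ∑ y ∈ (G.induce V₁).neighborFinset ⟨x, hx⟩, h y := by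
    symm
    refine Finset.sum_bij (fun y _ => y.val) ?_ (fun _ _ _ _ => Subtype.ext) ?_ (fun _ _ => rfl)
    · intro y hy
      simpa using hy
    · intro y hy
      rw [Finset.mem_filter, SimpleGraph.mem_neighborFinset] at hy
      exact ⟨⟨y, hy.2⟩, by simpa using hy.1, rfl⟩
  have eigen := hh x
  rw [← Finset.sum_filter_add_sum_filter_not _ (· ∈ V₁), sum_outside, sum_inside] at eigen
  linarith [hanti x]
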